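/- Let U_P be a pattern group and let λ, μ, ν ∈ 𝔫_P* satisfy λ = μ + ν, where no row index carries nonzero entries of both μ and ν and no column index carries nonzero entries of both μ and ν. Then the left orbit sizes satisfy |U_Pλ| = |U_Pμ| · |U_Pν|, and for every λ' in the two-sided orbit U_PλU_P, the number of pairs (γ, δ) ∈ (U_PμU_P) × (U_PνU_P) with λ' = γ + δ equals |U_PμU_P| · |U_PνU_P| / |U_PλU_P|. -/

import Mathlib

open Matrix BigOperators
open scoped Classical

/-- `n × n` matrices over `F`. -/
abbrev Mat (n : ℕ) (F : Type*) := Matrix (Fin n) (Fin n) F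

section Defs

variable {n : ℕ} {F : Type*} [Field F] [Fintype F]

/-- The pattern group `U_P` attached to a relation `P` on `{0,…,n-1}`:
unipotent upper-triangular matrices supported (off the diagonal) on positions `(i,j)` with `P i j`. -/
def patGroup (P : Fin n → Fin n → Prop) : Set (Mat n F) :=
  {u | (∀ i, u i i = 1) ∧ ∀ i j, i ≠ j → ¬ P i j → u i j = 0}

/-- Truncation of a matrix to the positions allowed by `P` (used to identify a functional on
`𝔫_P` with the matrix of its coefficients on allowable positions). -/
noncomputable def truncP (P : Fin n → Fin n → Prop) (A : Mat n F) : Mat n F :=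
  Matrix.of fun i j => if P i j then A i j else 0

/-- The left orbit `U_P λ` of the functional (identified with a matrix) `lam`:
`(aλ)(x) = λ(a⁻¹ x)`, whose coefficient matrix is the truncation of `(a⁻¹)ᵀ * λ`. -/
noncomputable def dualLeftOrbit (P : Fin n → Fin n → Prop) (lam : Mat n F) : Set (Mat n F) :=
  {mu | ∃ a ∈ (patGroup P : Set (Mat n F)), mu = truncP P ((a⁻¹)ᵀ * lam)}

/-- The two-sided orbit `U_P λ U_P` of the functional `lam`: `(aλb)(x) = λ(a⁻¹ x b⁻¹)`,
whose coefficient matrix is the truncation of `(a⁻¹)ᵀ * λ * (b⁻¹)ᵀ`. -/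
noncomputable def dualOrbit (P : Fin n → Fin n → Prop) (lam : Mat n F) : Set (Mat n F) :=
  {mu | ∃ a ∈ (patGroup P : Set (Mat n F)), ∃ b ∈ (patGroup P : Set (Mat n F)),
    mu = truncP P ((a⁻¹)ᵀ * lam * (b⁻¹)ᵀ)}

/-- The two-sided superclass orbit `{a (v-1) b : a, b ∈ U_P}` attached to `v ∈ U_P`. -/
def classOrbit (P : Fin n → Fin n → Prop) (v : Mat n F) : Set (Mat n F) :=
  {x | ∃ a ∈ (patGroup P : Set (Mat n F)), ∃ b ∈ (patGroup P : Set (Mat n F)),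
    x = a * (v - 1) * b}

/-- The pairing `λ(x) = Σ_{i,j} λ_{ij} x_{ij}` of a functional-matrix with a matrix. -/
def pairM (A B : Mat n F) : F := ∑ i, ∑ j, A i j * B i j

/-- The supercharacter `χ^λ` of the pattern group `U_P` attached to the functional `lam`:
`χ^λ(u) = (|U_Pλ|/|U_PλU_P|) Σ_{μ ∈ U_PλU_P} θ(−μ(u−1))`. -/
noncomputable def superChar (P : Fin n → Fin n → Prop) (θ : AddChar F ℂ)
    (lam u : Mat n F) : ℂ :=
  ((dualLeftOrbit P lam).ncard : ℂ) / ((dualOrbit P lam).ncard : ℂ) *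
    ∑ᶠ mu ∈ dualOrbit P lam, θ (- pairM mu (u - 1))

/-- The full order `i < j`, whose pattern group is `U_n`. -/
def Plt (n : ℕ) : Fin n → Fin n → Prop := fun i j => i < j

/-- The poset `𝒫_(m)` (in 0-based indexing): `i < j`, except that row `0` (row `1` in 1-based
indexing) is only comparable to columns `j` with 1-based value `j+1 > m`.  Its pattern group is
the interpolating group `U_(m)`. -/
def Pm (n m : ℕ) : Fin n → Fin n → Prop := fun i j => i < j ∧ (i.val = 0 → m < j.val + 1)

/-- `𝒮_n(q)`: strictly upper-triangular matrices with at most one nonzero entry in each row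
and each column. -/
def Sset (n : ℕ) (F : Type*) [Field F] : Set (Mat n F) :=
  {lam | (∀ i j : Fin n, ¬ i < j → lam i j = 0) ∧
    (∀ (i j j' : Fin n), lam i j ≠ 0 → lam i j' ≠ 0 → j = j') ∧
    (∀ (i i' j : Fin n), lam i j ≠ 0 → lam i' j ≠ 0 → i = i')}

/-- Adjacency of two nonzero positions of `A` (they share a row or a column): the edges of
the graph `G_A`. -/
def adjRel (A : Mat n F) (p q : Fin n × Fin n) : Prop :=
  p ≠ q ∧ A p.1 p.2 ≠ 0 ∧ A q.1 q.2 ≠ 0 ∧ (p.1 = q.1 ∨ p.2 = q.2)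

/-- The connected component of the position `p` in the graph `G_A`. -/
def compOf (A : Mat n F) (p : Fin n × Fin n) : Set (Fin n × Fin n) :=
  {q | Relation.ReflTransGen (adjRel A) p q}

/-- The set of connected components of the graph `G_A`. -/
def comps (A : Mat n F) : Set (Set (Fin n × Fin n)) :=
  {S | ∃ p : Fin n × Fin n, A p.1 p.2 ≠ 0 ∧ S = compOf A p}

/-- The matrix agreeing with `A` on the positions of `S` and vanishing elsewhere. -/
noncomputable def restrictTo (S : Set (Fin n × Fin n)) (A : Mat n F) : Mat n F :=
  Matrix.of fun i j => if (i, j) ∈ S then A i j else 0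

/-- At most one connected component of `G_A` has more than one vertex. -/
def AtMostOneBig (A : Mat n F) : Prop :=
  ∀ p q : Fin n × Fin n, A p.1 p.2 ≠ 0 → A q.1 q.2 ≠ 0 →
    1 < (compOf A p).ncard → 1 < (compOf A q).ncard → compOf A p = compOf A q

end Defs

section PatternGroup

variable {n : ℕ} {F : Type*} [Field F] {P : Fin n → Fin n → Prop}

lemma one_mem_patGroup : (1 : Mat n F) ∈ patGroup P :=
  ⟨fun i => one_apply_eq i, fun _ _ hij _ => one_apply_ne hij⟩

lemma eq_or_rel_of_mem_patGroup {A : Mat n F} (hA : A ∈ patGroup P) {i j : Fin n}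
    (h : A i j ≠ 0) : i = j ∨ P i j := by
  by_contra! hc
  exact h (hA.2 i j hc.1 hc.2)

lemma mul_mem_patGroup (hP1 : ∀ i j, P i j → i < j) (hP2 : ∀ i j k, P i j → P j k → P i k)
    {A B : Mat n F} (hA : A ∈ patGroup P) (hB : B ∈ patGroup P) : A * B ∈ patGroup P := by
  refine ⟨fun i => ?_, fun i j hij hPij => ?_⟩
  · rw [mul_apply, Finset.sum_eq_single i, hA.1, hB.1, one_mul]
    · intro k _ hk
      by_contra hc
      rcases eq_or_rel_of_mem_patGroup hA (left_ne_zero_of_mul hc) with h | h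
      · exact hk h.symm
      · rcases eq_or_rel_of_mem_patGroup hB (right_ne_zero_of_mul hc) with h' | h'
        · exact hk h'
        · exact lt_asymm (hP1 _ _ h) (hP1 _ _ h')
    · simp
  · rw [mul_apply]
    refine Finset.sum_eq_zero fun k _ => ?_
    by_contra hc
    rcases eq_or_rel_of_mem_patGroup hA (left_ne_zero_of_mul hc) with rfl | h <;>
      rcases eq_or_rel_of_mem_patGroup hB (right_ne_zero_of_mul hc) with rfl | h'
    · exact hij rfl
    · exact hPij h'
    · exact hPij h
    · exact hPij (hP2 _ _ _ h h')

lemma isUnit_of_mem_patGroup (hP1 : ∀ i j, P i j → i < j) {A : Mat n F}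
    (hA : A ∈ patGroup P) : IsUnit A := by
  rw [isUnit_iff_isUnit_det, det_of_isUpperTriangular]
  · simp [hA.1]
  · intro i j hij
    exact hA.2 i j (ne_of_gt hij) fun h => lt_asymm (hP1 _ _ h) hij

lemma inv_mem_patGroup [Fintype F] (hP1 : ∀ i j, P i j → i < j)
    (hP2 : ∀ i j k, P i j → P j k → P i k) {A : Mat n F} (hA : A ∈ patGroup P) :
    A⁻¹ ∈ patGroup P := by
  have hinj : Function.Injective
      (fun x : (patGroup P : Set (Mat n F)) =>
        (⟨A * x, mul_mem_patGroup hP1 hP2 hA x.2⟩ : (patGroup P : Set (Mat n F)))) :=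
    fun x y hxy => Subtype.ext ((isUnit_of_mem_patGroup hP1 hA).mul_left_cancel
      (congrArg Subtype.val hxy))
  obtain ⟨x, hx⟩ := Finite.surjective_of_injective hinj ⟨1, one_mem_patGroup⟩
  rw [inv_eq_right_inv (congrArg Subtype.val hx)]
  exact x.2

lemma exists_mem_patGroup_transpose_mul {M N A C : Mat n F}
    (hrow : ∀ i, (∃ j, M i j ≠ 0) → ∀ j, N i j = 0)
    (hA : A ∈ patGroup P) (hC : C ∈ patGroup P) :
    ∃ Z ∈ (patGroup P : Set (Mat n F)), Zᵀ * M = Aᵀ * M ∧ Zᵀ * N = Cᵀ * N := by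
  refine ⟨of fun i j => if ∃ l, M i l ≠ 0 then A i j else C i j, ⟨?_, ?_⟩, ?_, ?_⟩
  · intro i
    simp [hA.1, hC.1]
  · intro i j hij hPij
    simp [hA.2 i j hij hPij, hC.2 i j hij hPij]
  · ext i j
    simp only [mul_apply, transpose_apply, of_apply]
    refine Finset.sum_congr rfl fun k _ => ?_
    split_ifs with h
    · rfl
    · push Not at h
      simp [h j]
  · ext i j
    simp only [mul_apply, transpose_apply, of_apply]
    refine Finset.sum_congr rfl fun k _ => ?_
    split_ifs with h
    · simp [hrow k h j]
    · rfl

lemma exists_mem_patGroup_mul_transpose {M N B D : Mat n F}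
    (hcol : ∀ j, (∃ i, M i j ≠ 0) → ∀ i, N i j = 0)
    (hB : B ∈ patGroup P) (hD : D ∈ patGroup P) :
    ∃ W ∈ (patGroup P : Set (Mat n F)), M * Wᵀ = M * Bᵀ ∧ N * Wᵀ = N * Dᵀ := by
  refine ⟨of fun i j => if ∃ l, M l j ≠ 0 then B i j else D i j, ⟨?_, ?_⟩, ?_, ?_⟩
  · intro i
    simp [hB.1, hD.1]
  · intro i j hij hPij
    simp [hB.2 i j hij hPij, hD.2 i j hij hPij]
  · ext i j
    simp only [mul_apply, transpose_apply, of_apply]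
    refine Finset.sum_congr rfl fun k _ => ?_
    split_ifs with h
    · rfl
    · push Not at h
      simp [h i]
  · ext i j
    simp only [mul_apply, transpose_apply, of_apply]
    refine Finset.sum_congr rfl fun k _ => ?_
    split_ifs with h
    · simp [hcol k h i]
    · rfl

end PatternGroup

section DualOrbits

variable {n : ℕ} {F : Type*} [Field F] {P : Fin n → Fin n → Prop}

/-- The functional `x ↦ M (A x B)` on `𝔫_P`, as a truncated coefficient matrix. -/
noncomputable def dualAct (P : Fin n → Fin n → Prop) (A B M : Mat n F) : Mat n F :=
  truncP P (Aᵀ * M * Bᵀ)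

lemma truncP_add (A B : Mat n F) : truncP P (A + B) = truncP P A + truncP P B := by
  ext i j
  simp only [truncP, of_apply, Matrix.add_apply]
  split_ifs <;> simp

lemma truncP_truncP (A : Mat n F) : truncP P (truncP P A) = truncP P A := by
  ext i j
  simp only [truncP, of_apply]
  split_ifs <;> rfl

lemma dualAct_add (A B M N : Mat n F) :
    dualAct P A B (M + N) = dualAct P A B M + dualAct P A B N := by
  simp only [dualAct, mul_add, add_mul, truncP_add]

lemma dualAct_truncP (hP2 : ∀ i j k, P i j → P j k → P i k) {A B : Mat n F}
    (hA : A ∈ patGroup P) (hB : B ∈ patGroup P) (M : Mat n F) :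
    dualAct P A B (truncP P M) = dualAct P A B M := by
  ext i j
  simp only [dualAct, truncP, of_apply, mul_apply, transpose_apply]
  split_ifs with hij
  · refine Finset.sum_congr rfl fun l _ => ?_
    by_cases hl : B j l = 0
    · simp [hl]
    congr 1
    refine Finset.sum_congr rfl fun k _ => ?_
    by_cases hk : A k i = 0
    · simp [hk]
    have hil : P i l := by
      rcases eq_or_rel_of_mem_patGroup hB hl with rfl | h
      · exact hij
      · exact hP2 _ _ _ hij h
    have hkl : P k l := by
      rcases eq_or_rel_of_mem_patGroup hA hk with rfl | h
      · exact hil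
      · exact hP2 _ _ _ h hil
    rw [if_pos hkl]
  · rfl

lemma dualAct_dualAct (hP2 : ∀ i j k, P i j → P j k → P i k) {A B : Mat n F}
    (hA : A ∈ patGroup P) (hB : B ∈ patGroup P) (C D M : Mat n F) :
    dualAct P A B (dualAct P C D M) = dualAct P (C * A) (B * D) M := by
  rw [dualAct.eq_def P C D, dualAct_truncP hP2 hA hB]
  simp only [dualAct, transpose_mul, Matrix.mul_assoc]

lemma apply_eq_zero_of_mem_dualLeftOrbit {M X : Mat n F}
    (hX : X ∈ dualLeftOrbit P M) {j : Fin n} (hj : ∀ i, M i j = 0) (i : Fin n) : X i j = 0 := by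
  obtain ⟨a, -, rfl⟩ := hX
  simp [truncP, mul_apply, hj]

lemma truncP_of_mem_dualOrbit {M X : Mat n F} (hX : X ∈ dualOrbit P M) : truncP P X = X := by
  obtain ⟨a, -, b, -, rfl⟩ := hX
  exact truncP_truncP _

lemma injOn_add_dualLeftOrbit {M N : Mat n F}
    (hcol : ∀ j, (∃ i, M i j ≠ 0) → ∀ i, N i j = 0) :
    Set.InjOn (fun p : Mat n F × Mat n F => p.1 + p.2)
      (dualLeftOrbit P M ×ˢ dualLeftOrbit P N) := by
  rintro ⟨x, y⟩ ⟨hx, hy⟩ ⟨x', y'⟩ ⟨hx', hy'⟩ h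
  dsimp only at hx hy hx' hy' h
  have hxx : x = x' := by
    ext i j
    by_cases hj : ∃ i, M i j ≠ 0
    · simpa [apply_eq_zero_of_mem_dualLeftOrbit hy (hcol j hj),
        apply_eq_zero_of_mem_dualLeftOrbit hy' (hcol j hj)] using congrFun (congrFun h i) j
    · push Not at hj
      rw [apply_eq_zero_of_mem_dualLeftOrbit hx hj, apply_eq_zero_of_mem_dualLeftOrbit hx' hj]
  subst hxx
  exact Prod.ext rfl (add_left_cancel h)

variable [Fintype F]

lemma mem_dualOrbit_iff (hP1 : ∀ i j, P i j → i < j) (hP2 : ∀ i j k, P i j → P j k → P i k)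
    {M X : Mat n F} :
    X ∈ dualOrbit P M ↔ ∃ A ∈ (patGroup P : Set (Mat n F)),
      ∃ B ∈ (patGroup P : Set (Mat n F)), X = dualAct P A B M := by
  constructor
  · rintro ⟨a, ha, b, hb, rfl⟩
    exact ⟨_, inv_mem_patGroup hP1 hP2 ha, _, inv_mem_patGroup hP1 hP2 hb, rfl⟩
  · rintro ⟨A, hA, B, hB, rfl⟩
    refine ⟨_, inv_mem_patGroup hP1 hP2 hA, _, inv_mem_patGroup hP1 hP2 hB, ?_⟩
    rw [nonsing_inv_nonsing_inv _
        ((isUnit_iff_isUnit_det _).1 (isUnit_of_mem_patGroup hP1 hA)),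
      nonsing_inv_nonsing_inv _
        ((isUnit_iff_isUnit_det _).1 (isUnit_of_mem_patGroup hP1 hB)), dualAct]

lemma mem_dualLeftOrbit_iff (hP1 : ∀ i j, P i j → i < j)
    (hP2 : ∀ i j k, P i j → P j k → P i k) {M X : Mat n F} :
    X ∈ dualLeftOrbit P M ↔ ∃ A ∈ (patGroup P : Set (Mat n F)), X = truncP P (Aᵀ * M) := by
  constructor
  · rintro ⟨a, ha, rfl⟩
    exact ⟨_, inv_mem_patGroup hP1 hP2 ha, rfl⟩
  · rintro ⟨A, hA, rfl⟩
    refine ⟨_, inv_mem_patGroup hP1 hP2 hA, ?_⟩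
    rw [nonsing_inv_nonsing_inv _
        ((isUnit_iff_isUnit_det _).1 (isUnit_of_mem_patGroup hP1 hA))]

lemma dualAct_mem_dualOrbit (hP1 : ∀ i j, P i j → i < j)
    (hP2 : ∀ i j k, P i j → P j k → P i k) {A B M X : Mat n F}
    (hA : A ∈ patGroup P) (hB : B ∈ patGroup P) (hX : X ∈ dualOrbit P M) :
    dualAct P A B X ∈ dualOrbit P M := by
  obtain ⟨C, hC, D, hD, rfl⟩ := (mem_dualOrbit_iff hP1 hP2).1 hX
  exact (mem_dualOrbit_iff hP1 hP2).2 ⟨_, mul_mem_patGroup hP1 hP2 hC hA, _,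
    mul_mem_patGroup hP1 hP2 hB hD, dualAct_dualAct hP2 hA hB C D M⟩

lemma dualAct_inv_dualAct (hP1 : ∀ i j, P i j → i < j)
    (hP2 : ∀ i j k, P i j → P j k → P i k) {A B : Mat n F}
    (hA : A ∈ patGroup P) (hB : B ∈ patGroup P) (M : Mat n F) :
    dualAct P A⁻¹ B⁻¹ (dualAct P A B M) = truncP P M := by
  rw [dualAct_dualAct hP2 (inv_mem_patGroup hP1 hP2 hA) (inv_mem_patGroup hP1 hP2 hB),
    mul_nonsing_inv _ ((isUnit_iff_isUnit_det _).1 (isUnit_of_mem_patGroup hP1 hA)),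
    nonsing_inv_mul _ ((isUnit_iff_isUnit_det _).1 (isUnit_of_mem_patGroup hP1 hB))]
  simp [dualAct]

lemma exists_dualAct_eq (hP1 : ∀ i j, P i j → i < j)
    (hP2 : ∀ i j k, P i j → P j k → P i k) {M X Y : Mat n F}
    (hX : X ∈ dualOrbit P M) (hY : Y ∈ dualOrbit P M) :
    ∃ A ∈ (patGroup P : Set (Mat n F)), ∃ B ∈ (patGroup P : Set (Mat n F)),
      dualAct P A B X = Y := by
  obtain ⟨A, hA, B, hB, rfl⟩ := (mem_dualOrbit_iff hP1 hP2).1 hX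
  obtain ⟨C, hC, D, hD, rfl⟩ := (mem_dualOrbit_iff hP1 hP2).1 hY
  have hA' := inv_mem_patGroup hP1 hP2 hA
  have hB' := inv_mem_patGroup hP1 hP2 hB
  refine ⟨_, mul_mem_patGroup hP1 hP2 hA' hC, _, mul_mem_patGroup hP1 hP2 hD hB', ?_⟩
  rw [← dualAct_dualAct hP2 hC hD, dualAct_inv_dualAct hP1 hP2 hA hB, dualAct_truncP hP2 hC hD]

/-- The pairs in `(U_P M U_P) × (U_P N U_P)` summing to `X`. -/
def dualSumFiber (P : Fin n → Fin n → Prop) (M N X : Mat n F) : Set (Mat n F × Mat n F) :=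
  {p | p.1 ∈ dualOrbit P M ∧ p.2 ∈ dualOrbit P N ∧ X = p.1 + p.2}

lemma ncard_dualSumFiber_le (hP1 : ∀ i j, P i j → i < j)
    (hP2 : ∀ i j k, P i j → P j k → P i k) {L M N X Y : Mat n F}
    (hX : X ∈ dualOrbit P L) (hY : Y ∈ dualOrbit P L) :
    (dualSumFiber P M N X).ncard ≤ (dualSumFiber P M N Y).ncard := by
  obtain ⟨A, hA, B, hB, rfl⟩ := exists_dualAct_eq hP1 hP2 hX hY
  have hinj {K : Mat n F} : Set.InjOn (dualAct P A B) (dualOrbit P K) := by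
    intro x hx y hy hxy
    rw [← truncP_of_mem_dualOrbit hx, ← truncP_of_mem_dualOrbit hy,
      ← dualAct_inv_dualAct hP1 hP2 hA hB, hxy, dualAct_inv_dualAct hP1 hP2 hA hB]
  refine Set.ncard_le_ncard_of_injOn (Prod.map (dualAct P A B) (dualAct P A B)) ?_ ?_
    (Set.toFinite _)
  · rintro ⟨x, y⟩ ⟨hx, hy, rfl⟩
    exact ⟨dualAct_mem_dualOrbit hP1 hP2 hA hB hx, dualAct_mem_dualOrbit hP1 hP2 hA hB hy,
      dualAct_add _ _ _ _⟩
  · rintro ⟨x, y⟩ ⟨hx, hy, -⟩ ⟨x', y'⟩ ⟨hx', hy', -⟩ h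
    exact Prod.ext (hinj hx hx' (congrArg Prod.fst h)) (hinj hy hy' (congrArg Prod.snd h))

lemma add_mem_dualOrbit (hP1 : ∀ i j, P i j → i < j)
    (hP2 : ∀ i j k, P i j → P j k → P i k) {M N X Y : Mat n F}
    (hrow : ∀ i, (∃ j, M i j ≠ 0) → ∀ j, N i j = 0)
    (hcol : ∀ j, (∃ i, M i j ≠ 0) → ∀ i, N i j = 0)
    (hX : X ∈ dualOrbit P M) (hY : Y ∈ dualOrbit P N) : X + Y ∈ dualOrbit P (M + N) := by
  obtain ⟨A, hA, B, hB, rfl⟩ := (mem_dualOrbit_iff hP1 hP2).1 hX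
  obtain ⟨C, hC, D, hD, rfl⟩ := (mem_dualOrbit_iff hP1 hP2).1 hY
  obtain ⟨Z, hZ, hZM, hZN⟩ := exists_mem_patGroup_transpose_mul hrow hA hC
  obtain ⟨W, hW, hWM, hWN⟩ := exists_mem_patGroup_mul_transpose hcol hB hD
  refine (mem_dualOrbit_iff hP1 hP2).2 ⟨Z, hZ, W, hW, ?_⟩
  rw [dualAct_add]
  simp only [dualAct, hZM, hZN, Matrix.mul_assoc, hWM, hWN]

lemma ncard_dualOrbit_mul (hP1 : ∀ i j, P i j → i < j)
    (hP2 : ∀ i j k, P i j → P j k → P i k) {M N X : Mat n F}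
    (hrow : ∀ i, (∃ j, M i j ≠ 0) → ∀ j, N i j = 0)
    (hcol : ∀ j, (∃ i, M i j ≠ 0) → ∀ i, N i j = 0)
    (hX : X ∈ dualOrbit P (M + N)) :
    (dualOrbit P M).ncard * (dualOrbit P N).ncard =
      (dualOrbit P (M + N)).ncard * (dualSumFiber P M N X).ncard := by
  rw [← Set.ncard_prod, Set.ncard_eq_toFinset_card' (_ ×ˢ _),
    Set.ncard_eq_toFinset_card' (dualOrbit P (M + N)),
    Finset.card_eq_sum_card_fiberwise (f := fun p => p.1 + p.2)
      (t := (dualOrbit P (M + N)).toFinset), Finset.sum_const_nat]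
  · intro Y hY
    rw [Set.mem_toFinset] at hY
    rw [(ncard_dualSumFiber_le hP1 hP2 hX hY).antisymm (ncard_dualSumFiber_le hP1 hP2 hY hX),
      Set.ncard_eq_toFinset_card']
    congr 1
    ext p
    simp only [Finset.mem_filter, Set.mem_toFinset, Set.mem_prod, and_assoc, eq_comm (b := Y)]
    rfl
  · intro p hp
    simp only [Set.coe_toFinset, Set.mem_prod] at hp ⊢
    exact add_mem_dualOrbit hP1 hP2 hrow hcol hp.1 hp.2

lemma image_add_dualLeftOrbit (hP1 : ∀ i j, P i j → i < j)
    (hP2 : ∀ i j k, P i j → P j k → P i k) {M N : Mat n F}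
    (hrow : ∀ i, (∃ j, M i j ≠ 0) → ∀ j, N i j = 0) :
    (fun p : Mat n F × Mat n F => p.1 + p.2) '' (dualLeftOrbit P M ×ˢ dualLeftOrbit P N) =
      dualLeftOrbit P (M + N) := by
  ext X
  constructor
  · rintro ⟨⟨x, y⟩, ⟨hx, hy⟩, rfl⟩
    obtain ⟨A, hA, rfl⟩ := (mem_dualLeftOrbit_iff hP1 hP2).1 hx
    obtain ⟨C, hC, rfl⟩ := (mem_dualLeftOrbit_iff hP1 hP2).1 hy
    obtain ⟨Z, hZ, hZM, hZN⟩ := exists_mem_patGroup_transpose_mul hrow hA hC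
    refine (mem_dualLeftOrbit_iff hP1 hP2).2 ⟨Z, hZ, ?_⟩
    rw [mul_add, truncP_add, hZM, hZN]
  · rintro ⟨a, ha, rfl⟩
    refine ⟨(truncP P (a⁻¹ᵀ * M), truncP P (a⁻¹ᵀ * N)), ⟨⟨a, ha, rfl⟩, ⟨a, ha, rfl⟩⟩, ?_⟩
    rw [mul_add, truncP_add]

end DualOrbits

/-- If `λ = μ + ν` in `𝔫_P^*` with `μ` and `ν` sharing no row and no column of
nonzero entries, then `|U_Pλ| = |U_Pμ| · |U_Pν|`, and for every `λ' ∈ U_PλU_P` the number of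
pairs `(γ, δ) ∈ (U_PμU_P) × (U_PνU_P)` with `λ' = γ + δ` equals
`|U_PμU_P| · |U_PνU_P| / |U_PλU_P|`. -/
theorem stmt14 {n : ℕ} {F : Type*} [Field F] [Fintype F]
    (P : Fin n → Fin n → Prop)
    (hP1 : ∀ i j : Fin n, P i j → i < j)
    (hP2 : ∀ i j k : Fin n, P i j → P j k → P i k)
    (lam mu nu : Mat n F)
    (hmu : ∀ i j : Fin n, ¬ P i j → mu i j = 0)
    (hnu : ∀ i j : Fin n, ¬ P i j → nu i j = 0)
    (hsum : lam = mu + nu)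
    (hrow : ∀ i : Fin n, (∃ j, mu i j ≠ 0) → ∀ j, nu i j = 0)
    (hcol : ∀ j : Fin n, (∃ i, mu i j ≠ 0) → ∀ i, nu i j = 0) :
    (dualLeftOrbit P lam).ncard = (dualLeftOrbit P mu).ncard * (dualLeftOrbit P nu).ncard ∧
    ∀ lam' ∈ dualOrbit P lam,
      ((Set.ncard {p : Mat n F × Mat n F |
          p.1 ∈ dualOrbit P mu ∧ p.2 ∈ dualOrbit P nu ∧ lam' = p.1 + p.2} : ℚ) =
        ((dualOrbit P mu).ncard * (dualOrbit P nu).ncard : ℚ) /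
          ((dualOrbit P lam).ncard : ℚ)) := by
  subst hsum
  refine ⟨?_, fun lam' hlam' => ?_⟩
  · rw [← image_add_dualLeftOrbit hP1 hP2 hrow,
      (injOn_add_dualLeftOrbit hcol).ncard_image, Set.ncard_prod]
  · have hpos : (0 : ℚ) < (dualOrbit P (mu + nu)).ncard := by
      exact_mod_cast (Set.ncard_pos (Set.toFinite _)).2 ⟨lam', hlam'⟩
    rw [eq_div_iff hpos.ne', mul_comm]
    exact_mod_cast (ncard_dualOrbit_mul hP1 hP2 hrow hcol hlam').symm
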